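/- Let m \le -1 and let u, a \in \mathbb{R} with a \ge 0 and x := 4u^2m^2 - 4a^2 > -\pi^2. If the two components of \Phi_m(u,a) are equal, i.e. e^{-2u(1+m)}(C(x) + 2umS(x)) = e^{2u(1+m)}(C(x) - 2umS(x)), then u = 0. (For m \le -1 the preimage under the reduced polar map of the fixed point set of the involution (s,t) \mapsto (t,s) is exactly the fixed point set of the involution u \mapsto -u.) -/

import Mathlib

open Real

/-- `C x = ∑ xⁿ/(2n)!`, i.e. `cosh √x` for `x ≥ 0` and `cos √(-x)` for `x ≤ 0`. -/
noncomputable def C (x : ℝ) : ℝ := ∑' n : ℕ, x ^ n / (Nat.factorial (2 * n))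

/-- `S x = ∑ xⁿ/(2n+1)!`, i.e. `sinh √x/√x` for `x > 0` and `sin √(-x)/√(-x)` for `x < 0`. -/
noncomputable def S (x : ℝ) : ℝ := ∑' n : ℕ, x ^ n / (Nat.factorial (2 * n + 1))

theorem C_sq (y : ℝ) : C (y ^ 2) = cosh y := by
  rw [C, ← (hasSum_cosh y).tsum_eq]
  simp_rw [pow_mul]

theorem mul_S_sq (y : ℝ) : y * S (y ^ 2) = sinh y := by
  rw [S, ← (hasSum_sinh y).tsum_eq, ← tsum_mul_left]
  congr 1 with n
  rw [pow_succ y (2 * n), pow_mul]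
  ring

theorem C_neg_sq (y : ℝ) : C (-y ^ 2) = cos y := by
  rw [C, ← (hasSum_cos y).tsum_eq]
  congr 1 with n
  rw [neg_pow, pow_mul]

theorem mul_S_neg_sq (y : ℝ) : y * S (-y ^ 2) = sin y := by
  rw [S, ← (hasSum_sin y).tsum_eq, ← tsum_mul_left]
  congr 1 with n
  rw [neg_pow, pow_succ y (2 * n), pow_mul]
  ring

theorem C_zero : C 0 = 1 := by
  simpa using C_sq 0

theorem S_zero : S 0 = 1 := by
  rw [S, tsum_eq_single 0]
  · simp
  · intro n hn
    simp [hn]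

theorem mul_sinh_le_mul_sinh {d s : ℝ} (hd : 0 ≤ d) (hds : d ≤ s) :
    s * sinh d ≤ d * sinh s := by
  refine hasSum_le (fun n => ?_) ((hasSum_sinh d).mul_left s) ((hasSum_sinh s).mul_left d)
  have hpow : d ^ (2 * n) ≤ s ^ (2 * n) := by gcongr
  calc s * (d ^ (2 * n + 1) / (2 * n + 1).factorial)
      = s * d / (2 * n + 1).factorial * d ^ (2 * n) := by ring
    _ ≤ s * d / (2 * n + 1).factorial * s ^ (2 * n) := by
      have := hd.trans hds
      gcongr
    _ = d * (s ^ (2 * n + 1) / (2 * n + 1).factorial) := by ring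

theorem mul_cosh_mul_sinh_le {y p : ℝ} (hy : 0 ≤ y) (hyp : y ≤ p) :
    y * (cosh y * sinh p) ≤ p * (sinh y * cosh p) := by
  have h := mul_sinh_le_mul_sinh (sub_nonneg.2 hyp) (show p - y ≤ p + y by linarith)
  rw [sinh_sub, sinh_add] at h
  linarith

theorem sinh_le_mul_cosh {p : ℝ} (hp : 0 ≤ p) : sinh p ≤ p * cosh p := by
  refine hasSum_le (fun n => ?_) (hasSum_sinh p) ((hasSum_cosh p).mul_left p)
  calc p ^ (2 * n + 1) / (2 * n + 1).factorial
      ≤ p ^ (2 * n + 1) / (2 * n).factorial := by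
        have := Nat.factorial_pos (2 * n)
        gcongr
        omega
    _ = p * (p ^ (2 * n) / (2 * n).factorial) := by ring

theorem S_pos {x : ℝ} (hx : -π ^ 2 < x) : 0 < S x := by
  rcases lt_trichotomy x 0 with h | rfl | h
  · have hy := sqrt_pos.2 (neg_pos.2 h)
    have hyx : -√(-x) ^ 2 = x := by rw [sq_sqrt (by linarith)]; ring
    have hyπ : √(-x) < π := (sqrt_lt' pi_pos).2 (by linarith)
    have hS := mul_S_neg_sq √(-x)
    rw [hyx] at hS
    exact pos_of_mul_pos_right (hS ▸ sin_pos_of_pos_of_lt_pi hy hyπ) hy.le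
  · simp [S_zero]
  · have hy := sqrt_pos.2 h
    have hS := mul_S_sq √x
    rw [sq_sqrt h.le] at hS
    exact pos_of_mul_pos_right (hS ▸ sinh_pos_iff.2 hy) hy.le

theorem C_le_S {x : ℝ} (hx : -π ^ 2 < x) (hx0 : x ≤ 0) : C x ≤ S x := by
  rcases hx0.eq_or_lt with rfl | h
  · rw [C_zero, S_zero]
  · have hy := sqrt_pos.2 (neg_pos.2 h)
    have hyx : -√(-x) ^ 2 = x := by rw [sq_sqrt (by linarith)]; ring
    have hyπ : √(-x) < π := (sqrt_lt' pi_pos).2 (by linarith)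
    have hS := mul_S_neg_sq √(-x)
    have hC := C_neg_sq √(-x)
    rw [hyx] at hS hC
    rcases lt_or_ge √(-x) (π / 2) with hlt | hge
    · have hcos := cos_pos_of_mem_Ioo ⟨by linarith, hlt⟩
      have htan := lt_tan hy hlt
      rw [tan_eq_sin_div_cos, lt_div_iff₀ hcos, ← hS, ← hC] at htan
      exact (lt_of_mul_lt_mul_left htan hy.le).le
    · rw [hC]
      exact (cos_nonpos_of_pi_div_two_le_of_le hge (by linarith [pi_pos])).trans (S_pos hx).le

theorem C_mul_sinh_lt {p q x : ℝ} (hp : 0 ≤ p) (hpq : p < q) (hx : -π ^ 2 < x)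
    (hxq : x ≤ q ^ 2) : C x * sinh p < q * S x * cosh p := by
  have hS := S_pos hx
  have hcosh := cosh_pos p
  have hSc := mul_pos hS hcosh
  rcases le_or_gt x 0 with h | h
  · calc C x * sinh p ≤ S x * (p * cosh p) := by
          have := sinh_nonneg_iff.2 hp
          exact mul_le_mul (C_le_S hx h) (sinh_le_mul_cosh hp) this hS.le
      _ < q * S x * cosh p := by nlinarith
  · have hy := sqrt_pos.2 h
    have hyq : √x ≤ q := sqrt_le_iff.2 ⟨hp.trans hpq.le, hxq⟩
    have hSy := mul_S_sq √x
    have hCy := C_sq √x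
    rw [sq_sqrt h.le] at hSy hCy
    rcases le_or_gt √x p with hyp | hyp
    · have hle := mul_cosh_mul_sinh_le hy.le hyp
      rw [← hCy, ← hSy] at hle
      have : C x * sinh p ≤ p * (S x * cosh p) := by
        refine le_of_mul_le_mul_left ?_ hy
        linarith
      nlinarith
    · have hlt := sinh_pos_iff.2 (sub_pos.2 hyp)
      rw [sinh_sub, ← hCy, ← hSy] at hlt
      nlinarith

theorem S_mul_cosh_eq_of_exp_mul_eq {p q c s : ℝ}
    (h : exp (-p) * (c + q * s) = exp p * (c - q * s)) : q * s * cosh p = c * sinh p := by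
  rw [cosh_eq, sinh_eq]
  linarith


/-- For `m ≤ -1`, `a ≥ 0`, `x = 4u²m² - 4a² > -π²`: if the two components of the reduced
polar map `Φₘ(u,a)` coincide, then `u = 0`. -/
theorem stmt14 (m u a : ℝ) (hm : m ≤ -1) (ha : 0 ≤ a)
    (hx : 4 * u ^ 2 * m ^ 2 - 4 * a ^ 2 > -π ^ 2)
    (heq : Real.exp (-(2 * u * (1 + m))) *
        (C (4 * u ^ 2 * m ^ 2 - 4 * a ^ 2) + 2 * u * m * S (4 * u ^ 2 * m ^ 2 - 4 * a ^ 2)) =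
      Real.exp (2 * u * (1 + m)) *
        (C (4 * u ^ 2 * m ^ 2 - 4 * a ^ 2) - 2 * u * m * S (4 * u ^ 2 * m ^ 2 - 4 * a ^ 2))) :
    u = 0 := by
  have h := S_mul_cosh_eq_of_exp_mul_eq heq
  have hxq : 4 * u ^ 2 * m ^ 2 - 4 * a ^ 2 ≤ (2 * u * m) ^ 2 := by nlinarith
  rcases lt_trichotomy u 0 with hu | hu | hu
  · have hlt := C_mul_sinh_lt (p := 2 * u * (1 + m)) (q := 2 * u * m)
      (by nlinarith) (by linarith) hx hxq
    linarith
  · exact hu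
  · have hlt := C_mul_sinh_lt (p := -(2 * u * (1 + m))) (q := -(2 * u * m))
      (by nlinarith) (by linarith) hx (by rwa [neg_sq])
    rw [sinh_neg, cosh_neg] at hlt
    linarith
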